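/- arXiv:2309.07554 — 2 statements merged into one kernel-verified Lean document; each statement's English description precedes it below -/
import Mathlib

section
/- Let U and X be real Banach spaces, 𝒜 ⊆ U open, F : 𝒜 → X continuous, and ∂F a set-valued map assigning to each u ∈ 𝒜 a nonempty set ∂F(u) of continuous linear operators from U to X. Suppose ū ∈ 𝒜 satisfies F(ū) = 0, F is ∂F-semismooth at ū, and there exist a neighborhood V ⊆ 𝒜 of ū and a constant C_F > 0 such that every M ∈ ∂F(u) with u ∈ V is a bijective continuous linear operator whose inverse is continuous with operator norm ‖M⁻¹‖_{𝓛(X,U)} ≤ C_F. Then there exists δ > 0 such that for every u₀ with ‖u₀ − ū‖_U ≤ δ, every sequence (u_j)_{j≥0} generated by the semismooth Newton iteration — i.e., u_{j+1} = u_j + v_j where M_j ∈ ∂F(u_j) and M_j v_j = −F(u_j) — remains in V and converges superlinearly to ū, meaning that for every ε > 0 there is J such that ‖u_{j+1} − ū‖_U ≤ ε ‖u_j − ū‖_U for all j ≥ J. -/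
open Filter Topology

/-- One Newton step from a point `u` satisfying the semismoothness estimate with constant `ε`
contracts the distance to the solution by the factor `C * ε`. -/
theorem norm_newton_step_sub_le {U X : Type*} [NormedAddCommGroup U] [NormedSpace ℝ U]
    [NormedAddCommGroup X] [NormedSpace ℝ X] {M : U →L[ℝ] X} {Minv : X →L[ℝ] U} {C ε : ℝ}
    {u u' a : U} {y : X} (hleft : ∀ w, Minv (M w) = w) (hC : ‖Minv‖ ≤ C)
    (hstep : M (u' - u) = -y) (hy : ‖y - M (u - a)‖ ≤ ε * ‖u - a‖) :
    ‖u' - a‖ ≤ C * ε * ‖u - a‖ := by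
  have hM : M (u' - a) = -(y - M (u - a)) := by
    rw [← sub_add_sub_cancel u' u a, map_add, hstep]
    abel
  calc ‖u' - a‖ = ‖Minv (-(y - M (u - a)))‖ := by rw [← hM, hleft]
    _ ≤ C * ‖-(y - M (u - a))‖ := Minv.le_of_opNorm_le hC _
    _ ≤ C * (ε * ‖u - a‖) := by
      rw [norm_neg]
      exact mul_le_mul_of_nonneg_left hy ((norm_nonneg _).trans hC)
    _ = C * ε * ‖u - a‖ := by ring

/-- A sequence whose distance to `a` is halved at each step taken from within the closed ball of
radius `δ` around `a` decays geometrically once it starts in that ball. -/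
theorem norm_sub_le_geometric_of_local_halving {U : Type*} [NormedAddCommGroup U] {u : ℕ → U}
    {a : U} {δ : ℝ} (h0 : ‖u 0 - a‖ ≤ δ)
    (hstep : ∀ j, ‖u j - a‖ ≤ δ → ‖u (j + 1) - a‖ ≤ 1 / 2 * ‖u j - a‖) (j : ℕ) :
    ‖u j - a‖ ≤ (1 / 2) ^ j * δ := by
  have hδ : 0 ≤ δ := (norm_nonneg _).trans h0
  induction j with
  | zero => simpa using h0
  | succ k ih =>
    have hk : ‖u k - a‖ ≤ δ :=
      ih.trans (mul_le_of_le_one_left hδ (pow_le_one₀ (by norm_num) (by norm_num)))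
    have := hstep k hk
    rw [pow_succ]
    linarith

/-- **Convergence of the semismooth Newton method** (Theorem 4.1).
Let `U` and `X` be real Banach spaces, `𝒜 ⊆ U` open, `F : 𝒜 → X` continuous, and `DF` a
set-valued map assigning to each `u ∈ 𝒜` a nonempty set of continuous linear operators
`U → X`.  If `ubar ∈ 𝒜` solves `F(ubar) = 0`, `F` is `DF`-semismooth at `ubar`, and on a neighborhood
`V ⊆ 𝒜` of `ubar` every `M ∈ DF(u)` is invertible with `‖M⁻¹‖ ≤ C_F`, then there is `δ > 0` such
that any semismooth Newton sequence started at `u₀` with `‖u₀ − ubar‖ ≤ δ` stays in `V` and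
converges superlinearly to `ubar`. -/
theorem semismooth_newton_superlinear_convergence
    {U X : Type*} [NormedAddCommGroup U] [NormedSpace ℝ U] [CompleteSpace U]
    [NormedAddCommGroup X] [NormedSpace ℝ X] [CompleteSpace X]
    (𝒜 : Set U) (h𝒜 : IsOpen 𝒜)
    (F : U → X) (hFcont : ContinuousOn F 𝒜)
    (DF : U → Set (U →L[ℝ] X)) (hDF : ∀ u ∈ 𝒜, (DF u).Nonempty)
    (ubar : U) (hubar : ubar ∈ 𝒜) (hFubar : F ubar = 0)
    -- `F` is `DF`-semismooth at `ubar`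
    (hss : ∀ ε > 0, ∃ ρ > 0, ∀ v : U, 0 < ‖v‖ → ‖v‖ ≤ ρ → ubar + v ∈ 𝒜 →
      ∀ M ∈ DF (ubar + v), ‖F (ubar + v) - F ubar - M v‖ ≤ ε * ‖v‖)
    -- uniform invertibility of the generalized derivatives near `ubar`
    (V : Set U) (hV𝒜 : V ⊆ 𝒜) (hVnhds : V ∈ 𝓝 ubar) (C_F : ℝ) (hC_F : 0 < C_F)
    (hinv : ∀ u ∈ V, ∀ M ∈ DF u, ∃ Minv : X →L[ℝ] U,
      (∀ x : X, M (Minv x) = x) ∧ (∀ w : U, Minv (M w) = w) ∧ ‖Minv‖ ≤ C_F) :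
    ∃ δ > 0, ∀ u : ℕ → U, ‖u 0 - ubar‖ ≤ δ →
      -- `u` is generated by the semismooth Newton iteration
      (∀ j : ℕ, ∃ M ∈ DF (u j), M (u (j + 1) - u j) = -F (u j)) →
      (∀ j : ℕ, u j ∈ V) ∧
      Tendsto u atTop (𝓝 ubar) ∧
      ∀ ε > 0, ∃ J : ℕ, ∀ j ≥ J, ‖u (j + 1) - ubar‖ ≤ ε * ‖u j - ubar‖ := by
  have key : ∀ ε > 0, ∃ ρ > 0, ∀ u u' : U, ‖u - ubar‖ ≤ ρ →
      (∃ M ∈ DF u, M (u' - u) = -F u) → u ∈ V ∧ ‖u' - ubar‖ ≤ ε * ‖u - ubar‖ := by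
    intro ε hε
    obtain ⟨ρ, hρ, hs⟩ := hss (ε / C_F) (div_pos hε hC_F)
    obtain ⟨r, hr, hrV⟩ := Metric.nhds_basis_closedBall.mem_iff.1 hVnhds
    refine ⟨min ρ r, lt_min hρ hr, ?_⟩
    rintro u u' hu ⟨M, hM, hstep⟩
    have huV : u ∈ V := hrV (by
      rw [Metric.mem_closedBall, dist_eq_norm]
      exact hu.trans (min_le_right _ _))
    obtain ⟨Minv, -, hleft, hC⟩ := hinv u huV M hM
    have hest : ‖F u - M (u - ubar)‖ ≤ ε / C_F * ‖u - ubar‖ := by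
      rcases eq_or_ne u ubar with rfl | hne
      · simp [hFubar]
      · have := hs (u - ubar) (norm_pos_iff.2 (sub_ne_zero.2 hne)) (hu.trans (min_le_left _ _))
        simp only [add_sub_cancel, hFubar, sub_zero] at this
        exact this (hV𝒜 huV) M hM
    have hle := norm_newton_step_sub_le hleft hC hstep hest
    rw [mul_div_cancel₀ ε hC_F.ne'] at hle
    exact ⟨huV, hle⟩
  obtain ⟨δ, hδ, hhalf⟩ := key (1 / 2) (by norm_num)
  refine ⟨δ, hδ, fun u h0 hN => ?_⟩
  have hgeo := norm_sub_le_geometric_of_local_halving h0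
    fun j hj => (hhalf _ _ hj (hN j)).2
  have hball : ∀ j, ‖u j - ubar‖ ≤ δ := fun j =>
    (hgeo j).trans (mul_le_of_le_one_left hδ.le (pow_le_one₀ (by norm_num) (by norm_num)))
  have hlim : Tendsto (fun j => ‖u j - ubar‖) atTop (𝓝 0) := by
    refine squeeze_zero (fun _ => norm_nonneg _) hgeo ?_
    simpa using (tendsto_pow_atTop_nhds_zero_of_lt_one (r := (1 / 2 : ℝ)) (by norm_num)
      (by norm_num)).mul_const δ
  refine ⟨fun j => (hhalf _ _ (hball j) (hN j)).1, tendsto_iff_norm_sub_tendsto_zero.2 hlim, ?_⟩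
  intro ε hε
  obtain ⟨ρ, hρ, hs⟩ := key ε hε
  obtain ⟨J, hJ⟩ := eventually_atTop.1 (hlim.eventually_le_const hρ)
  exact ⟨J, fun j hj => (hs _ _ (hJ j hj) (hN j)).2⟩
end

section
/- Let (Ω, 𝔉) be a measurable space and a : Ω × ℝ → ℝ a function such that x ↦ a(x,y) is measurable for every y ∈ ℝ and y ↦ a(x,y) is continuously differentiable for every x ∈ Ω, with partial derivative ∂a/∂y. Let y₁, y₂ : Ω → ℝ be measurable functions. Then there exists a measurable function θ : Ω → [0,1] such that for every x ∈ Ω: a(x, y₁(x)) − a(x, y₂(x)) = (∂a/∂y)(x, y₂(x) + θ(x)(y₁(x) − y₂(x))) · (y₁(x) − y₂(x)). -/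
/-- The projection of the zero set of a Carathéodory function along a compact set is
measurable. -/
theorem measurableSet_exists_mem_eq_zero_of_isCompact
    {Ω ι : Type*} [MeasurableSpace Ω] [PseudoMetricSpace ι]
    {g : Ω → ι → ℝ} (hmeas : ∀ t, Measurable fun x => g x t) (hcont : ∀ x, Continuous (g x))
    {K : Set ι} (hK : IsCompact K) :
    MeasurableSet {x | ∃ t ∈ K, g x t = 0} := by
  obtain ⟨D, hDK, hDc, hKD⟩ := hK.isSeparable.exists_countable_dense_subset
  have heq : {x | ∃ t ∈ K, g x t = 0} =
      ⋂ n : ℕ, ⋃ t ∈ D, {x | |g x t| < 1 / ((n : ℝ) + 1)} := by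
    ext x
    simp only [Set.mem_ofPred_eq, Set.mem_iInter, Set.mem_iUnion, exists_prop]
    constructor
    · rintro ⟨t, htK, ht⟩ n
      have hopen : IsOpen {s | |g x s| < 1 / ((n : ℝ) + 1)} :=
        isOpen_lt (hcont x).abs continuous_const
      obtain ⟨s, hs, hsD⟩ := mem_closure_iff.1 (hKD htK) _ hopen
        (by simp only [Set.mem_ofPred_eq, ht, abs_zero]; positivity)
      exact ⟨s, hsD, hs⟩
    · intro h
      obtain ⟨s, hsD, -⟩ := h 0
      obtain ⟨t, htK, ht⟩ := hK.exists_isMinOn ⟨s, hDK hsD⟩ (hcont x).abs.continuousOn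
      refine ⟨t, htK, ?_⟩
      by_contra hne
      obtain ⟨n, hn⟩ := exists_nat_one_div_lt (abs_pos.2 hne)
      obtain ⟨r, hrD, hr⟩ := h n
      exact absurd (isMinOn_iff.1 ht r (hDK hrD)) (not_le.2 (hr.trans hn))
  rw [heq]
  exact .iInter fun n => .biUnion hDc fun t _ => measurableSet_lt (hmeas t).abs measurable_const

/-- A Carathéodory function all of whose sections vanish somewhere on `[a, b]` has a measurable
selection of zeros, namely the smallest ones. -/
theorem exists_measurable_mem_Icc_eq_zero
    {Ω : Type*} [MeasurableSpace Ω] {a b : ℝ}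
    {g : Ω → ℝ → ℝ} (hmeas : ∀ t, Measurable fun x => g x t) (hcont : ∀ x, Continuous (g x))
    (hzero : ∀ x, ∃ t ∈ Set.Icc a b, g x t = 0) :
    ∃ θ : Ω → ℝ, Measurable θ ∧ (∀ x, θ x ∈ Set.Icc a b) ∧ ∀ x, g x (θ x) = 0 := by
  have hleast : ∀ x, ∃ t, IsLeast {t | t ∈ Set.Icc a b ∧ g x t = 0} t := fun x =>
    (isCompact_Icc.inter_right (isClosed_eq (hcont x) continuous_const)).exists_isLeast (hzero x)
  choose θ hθ using hleast
  refine ⟨θ, measurable_of_Iic fun c => ?_, fun x => (hθ x).1.1, fun x => (hθ x).1.2⟩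
  have heq : θ ⁻¹' Set.Iic c = {x | ∃ t ∈ Set.Icc a (min b c), g x t = 0} := by
    ext x
    simp only [Set.mem_preimage, Set.mem_Iic, Set.mem_ofPred_eq]
    constructor
    · exact fun h => ⟨θ x, ⟨(hθ x).1.1.1, le_min (hθ x).1.1.2 h⟩, (hθ x).1.2⟩
    · rintro ⟨t, ⟨hat, ht⟩, hgt⟩
      exact ((hθ x).2 ⟨⟨hat, ht.trans (min_le_left _ _)⟩, hgt⟩).trans (ht.trans (min_le_right _ _))
  rw [heq]
  exact measurableSet_exists_mem_eq_zero_of_isCompact hmeas hcont isCompact_Icc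

/-- The derivative in the real variable of a function that is measurable in the parameter and
differentiable in the real variable is measurable in the parameter. -/
theorem measurable_deriv_of_measurable_param
    {Ω : Type*} [MeasurableSpace Ω] {a : Ω → ℝ → ℝ} (hmeas : ∀ y, Measurable fun x => a x y)
    (hdiff : ∀ x, Differentiable ℝ (a x)) (y : ℝ) :
    Measurable fun x => deriv (a x) y := by
  have hu : Filter.Tendsto (fun n : ℕ => 1 / ((n : ℝ) + 1)) Filter.atTop
      (nhdsWithin 0 {0}ᶜ) :=
    tendsto_nhdsWithin_iff.2 ⟨tendsto_one_div_add_atTop_nhds_zero_nat,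
      .of_forall fun n => (Nat.one_div_pos_of_nat).ne'⟩
  refine measurable_of_tendsto_metrizable
    (f := fun (n : ℕ) x => (1 / ((n : ℝ) + 1))⁻¹ • (a x (y + 1 / ((n : ℝ) + 1)) - a x y))
    (fun n => ((hmeas _).sub (hmeas y)).const_mul _) (tendsto_pi_nhds.2 fun x => ?_)
  exact (hasDerivAt_iff_tendsto_slope_zero.1 (hdiff x y).hasDerivAt).comp hu

/-- The **mean value theorem** on the segment from `v` to `u`, in any order. -/
theorem exists_mem_Icc_sub_eq_deriv_mul_sub {f : ℝ → ℝ} (hf : Differentiable ℝ f) (u v : ℝ) :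
    ∃ t ∈ Set.Icc (0 : ℝ) 1, f u - f v = deriv f (v + t * (u - v)) * (u - v) := by
  have hd : ∀ t : ℝ, HasDerivAt (fun t => f (v + t * (u - v)))
      (deriv f (v + t * (u - v)) * (u - v)) t := fun t => by
    have hline : HasDerivAt (fun t : ℝ => v + t * (u - v)) (u - v) t := by
      simpa using ((hasDerivAt_id t).mul_const (u - v)).const_add v
    exact (hf _).hasDerivAt.comp t hline
  obtain ⟨t, ht, h⟩ := exists_hasDerivAt_eq_slope _ _ zero_lt_one
    (fun t _ => (hd t).continuousAt.continuousWithinAt) (fun t _ => hd t)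
  exact ⟨t, Set.Ioo_subset_Icc_self ht, by simpa using h.symm⟩

/-- **Measurable mean value theorem.**  If `a : Ω × ℝ → ℝ` is a Carathéodory function that
is `C¹` in the second variable, and `y₁, y₂ : Ω → ℝ` are measurable, then there is a
measurable selection `θ : Ω → [0,1]` such that for every `x`,
`a(x,y₁(x)) − a(x,y₂(x)) = ∂a/∂y (x, y₂(x) + θ(x)(y₁(x) − y₂(x))) · (y₁(x) − y₂(x))`. -/
theorem measurable_mean_value_selection
    {Ω : Type*} [MeasurableSpace Ω]
    (a : Ω → ℝ → ℝ)
    (hmeas : ∀ y : ℝ, Measurable fun x => a x y)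
    (hC1 : ∀ x : Ω, ContDiff ℝ 1 (a x))
    (y₁ y₂ : Ω → ℝ) (hy₁ : Measurable y₁) (hy₂ : Measurable y₂) :
    ∃ θ : Ω → ℝ, Measurable θ ∧ (∀ x, θ x ∈ Set.Icc (0 : ℝ) 1) ∧
      ∀ x : Ω, a x (y₁ x) - a x (y₂ x) =
        deriv (a x) (y₂ x + θ x * (y₁ x - y₂ x)) * (y₁ x - y₂ x) := by
  have hdiff : ∀ x, Differentiable ℝ (a x) := fun x => (hC1 x).differentiable one_ne_zero
  have hderiv_cont : ∀ x, Continuous (deriv (a x)) := fun x => (hC1 x).continuous_deriv le_rfl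
  have ha : Measurable (Function.uncurry fun y x => a x y) :=
    MeasureTheory.measurable_uncurry_of_continuous_of_measurable (fun x => (hC1 x).continuous) hmeas
  have hderiv : Measurable (Function.uncurry fun y x => deriv (a x) y) :=
    MeasureTheory.measurable_uncurry_of_continuous_of_measurable hderiv_cont
      (measurable_deriv_of_measurable_param hmeas hdiff)
  obtain ⟨θ, hθ, hmem, hzero⟩ := exists_measurable_mem_Icc_eq_zero (a := 0) (b := 1)
    (g := fun x t => a x (y₁ x) - a x (y₂ x) -
      deriv (a x) (y₂ x + t * (y₁ x - y₂ x)) * (y₁ x - y₂ x))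
    (fun t => ((ha.comp (hy₁.prodMk measurable_id)).sub
      (ha.comp (hy₂.prodMk measurable_id))).sub
      ((hderiv.comp ((hy₂.add ((hy₁.sub hy₂).const_mul t)).prodMk measurable_id)).mul
        (hy₁.sub hy₂)))
    (fun x => continuous_const.sub
      (((hderiv_cont x).comp (by fun_prop)).mul continuous_const))
    (fun x => by
      simpa only [sub_eq_zero] using exists_mem_Icc_sub_eq_deriv_mul_sub (hdiff x) (y₁ x) (y₂ x))
  exact ⟨θ, hθ, hmem, fun x => sub_eq_zero.1 (hzero x)⟩
end
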